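/- Let X be a variable and e1, e2, e3 expressions, and let g3, g23 be expressions with X ∉ occ(g3) and X ∉ occ(g23) such that ν X = e3 ≡ ν X = g3 and ν X = e2 ∧ e3 ≡ ν X = g23. Then ν X = (e1 ⇒ e2 ◇ e3) ≡ ν X = (e1[X := g3] ⇒ g23 ◇ g3). -/

import Mathlib

namespace RESpaper

noncomputable section

/-- Addition on the extended reals in which `⊤` (i.e. `∞`) dominates. -/
def eadd (x y : EReal) : EReal := if x = ⊤ ∨ y = ⊤ then ⊤ else x + y

/-- The operator `eq-∞`. -/
def eqNegInfVal (x : EReal) : EReal := if x = ⊥ then ⊥ else ⊤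

/-- The operator `eq∞`. -/
def eqInfVal (x : EReal) : EReal := if x = ⊤ then ⊤ else ⊥

open Classical in
/-- The sum, with respect to `eadd`, of a finite family of extended reals. -/
def eSum {ι : Type*} (s : Finset ι) (e : ι → EReal) : EReal :=
  if ∃ i ∈ s, e i = ⊤ then ⊤ else ∑ i ∈ s, e i

/-- Syntax of expressions over a set `V` of variables. -/
inductive Expr (V : Type*) where
  | var : V → Expr V
  | const : EReal → Expr V
  | scale : {c : ℝ // 0 < c} → Expr V → Expr V
  | add : Expr V → Expr V → Expr V
  | emin : Expr V → Expr V → Expr V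
  | emax : Expr V → Expr V → Expr V
  | condL : Expr V → Expr V → Expr V → Expr V   -- (e₁ ⇒ e₂ ◇ e₃)
  | condR : Expr V → Expr V → Expr V → Expr V   -- (e₁ → e₂ ◇ e₃)
  | eqm : Expr V → Expr V                       -- eq-∞(e)

variable {V : Type*}

/-- Evaluation of an expression under a valuation `η`. -/
def Expr.eval (η : V → EReal) : Expr V → EReal
  | var X => η X
  | const d => d
  | scale c e => (c.1 : EReal) * Expr.eval η e
  | add e₁ e₂ => eadd (Expr.eval η e₁) (Expr.eval η e₂)
  | emin e₁ e₂ => Expr.eval η e₁ ⊓ Expr.eval η e₂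
  | emax e₁ e₂ => Expr.eval η e₁ ⊔ Expr.eval η e₂
  | condL e₁ e₂ e₃ =>
      if Expr.eval η e₁ ≤ 0 then Expr.eval η e₂ ⊓ Expr.eval η e₃ else Expr.eval η e₃
  | condR e₁ e₂ e₃ =>
      if Expr.eval η e₁ < 0 then Expr.eval η e₂ else Expr.eval η e₂ ⊔ Expr.eval η e₃
  | eqm e => eqNegInfVal (Expr.eval η e)

/-- The set of variables occurring in an expression. -/
def Expr.occ : Expr V → Set V
  | var X => {X}
  | const _ => ∅
  | scale _ e => Expr.occ e
  | add e₁ e₂ => Expr.occ e₁ ∪ Expr.occ e₂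
  | emin e₁ e₂ => Expr.occ e₁ ∪ Expr.occ e₂
  | emax e₁ e₂ => Expr.occ e₁ ∪ Expr.occ e₂
  | condL e₁ e₂ e₃ => Expr.occ e₁ ∪ Expr.occ e₂ ∪ Expr.occ e₃
  | condR e₁ e₂ e₃ => Expr.occ e₁ ∪ Expr.occ e₂ ∪ Expr.occ e₃
  | eqm e => Expr.occ e

/-- `e` contains no occurrence of the conditional operators. -/
def Expr.noCond : Expr V → Prop
  | var _ => True
  | const _ => True
  | scale _ e => Expr.noCond e
  | add e₁ e₂ => Expr.noCond e₁ ∧ Expr.noCond e₂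
  | emin e₁ e₂ => Expr.noCond e₁ ∧ Expr.noCond e₂
  | emax e₁ e₂ => Expr.noCond e₁ ∧ Expr.noCond e₂
  | condL _ _ _ => False
  | condR _ _ _ => False
  | eqm e => Expr.noCond e

/-- Syntactic substitution `e[X := g]`. -/
def Expr.subst [DecidableEq V] (X : V) (g : Expr V) : Expr V → Expr V
  | var Y => if Y = X then g else var Y
  | const d => const d
  | scale c e => scale c (Expr.subst X g e)
  | add e₁ e₂ => add (Expr.subst X g e₁) (Expr.subst X g e₂)
  | emin e₁ e₂ => emin (Expr.subst X g e₁) (Expr.subst X g e₂)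
  | emax e₁ e₂ => emax (Expr.subst X g e₁) (Expr.subst X g e₂)
  | condL e₁ e₂ e₃ => condL (Expr.subst X g e₁) (Expr.subst X g e₂) (Expr.subst X g e₃)
  | condR e₁ e₂ e₃ => condR (Expr.subst X g e₁) (Expr.subst X g e₂) (Expr.subst X g e₃)
  | eqm e => eqm (Expr.subst X g e)

/-- `(Σ_{(c,X) ∈ cs} c·X) + rest`. -/
def scaledSum (cs : List ({c : ℝ // 0 < c} × V)) (rest : Expr V) : Expr V :=
  cs.foldr (fun p acc => Expr.add (Expr.scale p.1 (Expr.var p.2)) acc) rest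

/-- `(Σ_{X ∈ ms} eq-∞(X)) + rest`. -/
def eqmSum (ms : List V) (rest : Expr V) : Expr V :=
  ms.foldr (fun X acc => Expr.add (Expr.eqm (Expr.var X)) acc) rest

/-- A term of the shape `(Σ_{X∈𝒳'} c^X·X) + (Σ_{X∈𝒳''} eq-∞(X)) + d`
with the variables in each of the two sums pairwise distinct. -/
def IsSimpleTerm (e : Expr V) : Prop :=
  ∃ (cs : List ({c : ℝ // 0 < c} × V)) (ms : List V) (d : EReal),
    (cs.map Prod.snd).Nodup ∧ ms.Nodup ∧ e = scaledSum cs (eqmSum ms (Expr.const d))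

/-- Finite disjunction; the empty disjunction is `−∞`. -/
def disjList : List (Expr V) → Expr V
  | [] => Expr.const ⊥
  | [e] => e
  | e :: es => Expr.emax e (disjList es)

/-- Finite conjunction; the empty conjunction is `∞`. -/
def conjList : List (Expr V) → Expr V
  | [] => Expr.const ⊤
  | [e] => e
  | e :: es => Expr.emin e (conjList es)

/-- Simple conjunctive normal form. -/
def IsSimpleCNF (e : Expr V) : Prop :=
  ∃ ls : List (List (Expr V)),
    (∀ l ∈ ls, ∀ t ∈ l, IsSimpleTerm t) ∧ e = conjList (ls.map disjList)

/-- Simple disjunctive normal form. -/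
def IsSimpleDNF (e : Expr V) : Prop :=
  ∃ ls : List (List (Expr V)),
    (∀ l ∈ ls, ∀ t ∈ l, IsSimpleTerm t) ∧ e = disjList (ls.map conjList)

/-- Conjunctive normal form. -/
inductive IsCNF : Expr V → Prop where
  | simple {e : Expr V} : IsSimpleCNF e → IsCNF e
  | condL {e₁ e₂ e₃ : Expr V} :
      IsSimpleCNF e₁ → IsCNF e₂ → IsCNF e₃ → IsCNF (Expr.condL e₁ e₂ e₃)
  | condR {e₁ e₂ e₃ : Expr V} :
      IsSimpleCNF e₁ → IsCNF e₂ → IsCNF e₃ → IsCNF (Expr.condR e₁ e₂ e₃)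

/-- Disjunctive normal form. -/
inductive IsDNF : Expr V → Prop where
  | simple {e : Expr V} : IsSimpleDNF e → IsDNF e
  | condL {e₁ e₂ e₃ : Expr V} :
      IsSimpleDNF e₁ → IsDNF e₂ → IsDNF e₃ → IsDNF (Expr.condL e₁ e₂ e₃)
  | condR {e₁ e₂ e₃ : Expr V} :
      IsSimpleDNF e₁ → IsDNF e₂ → IsDNF e₃ → IsDNF (Expr.condR e₁ e₂ e₃)

/-- Fixed-point symbols. -/
inductive FP where
  | mu : FP
  | nu : FP

/-- A real equation system: a finite sequence of fixed-point equations `σ X = e`. -/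
abbrev RES (V : Type*) := List (FP × V × Expr V)

/-- The bound variables of a RES. -/
def bnd (E : RES V) : List V := E.map (fun p => p.2.1)

variable [DecidableEq V]

/-- The solution `[[ℰ]]η` of a real equation system. -/
def sol : RES V → (V → EReal) → V → EReal
  | [], η => η
  | (FP.mu, X, e) :: E, η =>
      sol E (Function.update η X
        (sInf {r : EReal | Expr.eval (sol E (Function.update η X r)) e ≤ r}))
  | (FP.nu, X, e) :: E, η =>
      sol E (Function.update η X
        (sSup {r : EReal | r ≤ Expr.eval (sol E (Function.update η X r)) e}))

/-- Equivalence of real equation systems. -/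
def REquiv (E E' : RES V) : Prop :=
  ∀ F : RES V, (∀ Y ∈ bnd F, Y ∉ bnd E ∧ Y ∉ bnd E') →
    ∀ η : V → EReal, sol (E ++ F) η = sol (E' ++ F) η


theorem eadd_mono {a b c d : EReal} (hac : a ≤ c) (hbd : b ≤ d) : eadd a b ≤ eadd c d := by
  unfold eadd
  by_cases h : c = ⊤ ∨ d = ⊤
  · rw [if_pos h]; exact le_top
  · have h' : ¬ (a = ⊤ ∨ b = ⊤) := by
      rintro (rfl | rfl)
      · exact h (Or.inl (top_le_iff.mp hac))
      · exact h (Or.inr (top_le_iff.mp hbd))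
    rw [if_neg h, if_neg h']
    exact add_le_add hac hbd

theorem eqNegInfVal_mono : Monotone eqNegInfVal := by
  intro a b hab
  unfold eqNegInfVal
  split_ifs with ha hb hb
  · exact le_rfl
  · exact bot_le
  · exact absurd (le_bot_iff.mp (hb ▸ hab)) ha
  · exact le_rfl

/-- Evaluation is monotone in the valuation. -/
theorem Expr.eval_mono {W : Type*} (e : Expr W) :
    Monotone fun η : W → EReal => Expr.eval η e := by
  intro η θ h
  induction e with
  | var X => exact h X
  | const d => exact le_rfl
  | scale c e ih =>
    exact mul_le_mul_of_nonneg_left ih (EReal.coe_nonneg.mpr c.2.le)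
  | add e₁ e₂ ih₁ ih₂ => exact eadd_mono ih₁ ih₂
  | emin e₁ e₂ ih₁ ih₂ => exact inf_le_inf ih₁ ih₂
  | emax e₁ e₂ ih₁ ih₂ => exact sup_le_sup ih₁ ih₂
  | condL e₁ e₂ e₃ ih₁ ih₂ ih₃ =>
    simp only [Expr.eval] at ih₁ ih₂ ih₃ ⊢
    split_ifs with h₁ h₂ h₂
    · exact inf_le_inf ih₂ ih₃
    · exact inf_le_right.trans ih₃
    · exact absurd (ih₁.trans h₂) h₁
    · exact ih₃
  | condR e₁ e₂ e₃ ih₁ ih₂ ih₃ =>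
    simp only [Expr.eval] at ih₁ ih₂ ih₃ ⊢
    split_ifs with h₁ h₂ h₂
    · exact ih₂
    · exact ih₂.trans le_sup_left
    · exact absurd (ih₁.trans_lt h₂) h₁
    · exact sup_le_sup ih₂ ih₃
  | eqm e ih => exact eqNegInfVal_mono ih

theorem Expr.eval_update_of_notMem_occ (X : V) (r : EReal) (η : V → EReal) (e : Expr V)
    (h : X ∉ e.occ) : Expr.eval (Function.update η X r) e = Expr.eval η e := by
  induction e with
  | var Y =>
    have hY : Y ≠ X := fun hYX => h (by simp [Expr.occ, hYX])
    simp [Expr.eval, hY]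
  | _ => simp_all [Expr.occ, Expr.eval]

theorem Expr.eval_subst (X : V) (g : Expr V) (η : V → EReal) (e : Expr V) :
    Expr.eval η (Expr.subst X g e) = Expr.eval (Function.update η X (Expr.eval η g)) e := by
  induction e with
  | var Y =>
    by_cases hY : Y = X
    · subst hY; simp [Expr.subst, Expr.eval]
    · simp [Expr.subst, Expr.eval, hY]
  | _ => simp_all [Expr.subst, Expr.eval]

theorem sol_apply_of_notMem_bnd (F : RES V) (X : V) (h : X ∉ bnd F) (η : V → EReal) :
    sol F η X = η X := by
  induction F generalizing η with
  | nil => rfl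
  | cons p F ih =>
    obtain ⟨σ, Y, e⟩ := p
    simp only [bnd, List.map_cons, List.mem_cons, not_or] at h
    cases σ <;> simp [sol, ih h.2, h.1]

/-- The solution of a real equation system is monotone in the valuation. -/
theorem sol_mono (F : RES V) : Monotone (sol F) := by
  induction F with
  | nil => exact fun _ _ h => h
  | cons p F ih =>
    obtain ⟨σ, Y, e⟩ := p
    intro η θ h
    have hupd : ∀ {r s : EReal}, r ≤ s → Function.update η Y r ≤ Function.update θ Y s :=
      fun hrs => update_le_update_iff.mpr ⟨hrs, fun j _ => h j⟩
    cases σ with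
    | mu =>
      exact ih (hupd (sInf_le_sInf fun r hr => (e.eval_mono (ih (hupd le_rfl))).trans hr))
    | nu =>
      exact ih (hupd (sSup_le_sSup fun r hr => le_trans hr (e.eval_mono (ih (hupd le_rfl)))))

theorem le_apply_sSup_postfixed {α : Type*} [CompleteLattice α] {f : α → α} (hf : Monotone f) :
    sSup {r | r ≤ f r} ≤ f (sSup {r | r ≤ f r}) :=
  sSup_le fun _ hr => le_trans hr (hf (le_sSup hr))

/-- The greatest fixed point of a pointwise conditional is decided by its condition at the
greatest fixed point of the alternative branch. -/
theorem sSup_postfixed_cond {f₁ f₂ f₃ : EReal → EReal} (h₁ : Monotone f₁) (h₃ : Monotone f₃) :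
    sSup {r | r ≤ if f₁ r ≤ 0 then f₂ r ⊓ f₃ r else f₃ r} =
      if f₁ (sSup {r | r ≤ f₃ r}) ≤ 0 then sSup {r | r ≤ f₂ r ⊓ f₃ r}
      else sSup {r | r ≤ f₃ r} := by
  have hle : ∀ r, (r ≤ if f₁ r ≤ 0 then f₂ r ⊓ f₃ r else f₃ r) → r ≤ f₃ r := by
    intro r hr
    split_ifs at hr
    · exact hr.trans inf_le_right
    · exact hr
  split_ifs with hc
  · have hneg : ∀ {r}, r ≤ f₃ r → f₁ r ≤ 0 := fun {r} hr =>
      (h₁ (show r ≤ sSup {r | r ≤ f₃ r} from le_sSup hr)).trans hc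
    congr 1
    ext r
    refine ⟨fun hr => ?_, fun hr => ?_⟩
    · simpa only [Set.mem_ofPred_eq, if_pos (hneg (hle r hr))] using hr
    · simpa only [Set.mem_ofPred_eq, if_pos (hneg (le_trans hr inf_le_right))] using hr
  · refine le_antisymm (sSup_le_sSup hle) (le_sSup ?_)
    simp only [Set.mem_ofPred_eq, if_neg hc]
    exact le_apply_sSup_postfixed h₃

/-- Equivalent single greatest fixed-point equations have the same greatest fixed point in front of
every real equation system that does not bind their variable. -/
theorem REquiv.sSup_eq {X : V} {e g : Expr V} (h : REquiv [(FP.nu, X, e)] [(FP.nu, X, g)])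
    (F : RES V) (hF : X ∉ bnd F) (η : V → EReal) :
    sSup {r | r ≤ Expr.eval (sol F (Function.update η X r)) e} =
      sSup {r | r ≤ Expr.eval (sol F (Function.update η X r)) g} := by
  have hb : ∀ Y ∈ bnd F, Y ∉ bnd [(FP.nu, X, e)] ∧ Y ∉ bnd [(FP.nu, X, g)] := by
    intro Y hY
    have hYX : Y ≠ X := fun hYX => hF (hYX ▸ hY)
    simp [bnd, hYX]
  simpa [sol, sol_apply_of_notMem_bnd F X hF] using congrFun (h F hb η) X

/-- If `ν X = e` is solved by `g`, then `g` bounds every post-fixed value of `e`. -/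
theorem REquiv.le_eval {X : V} {e g : Expr V} (h : REquiv [(FP.nu, X, e)] [(FP.nu, X, g)])
    (hg : X ∉ g.occ) {η : V → EReal} (hη : η X ≤ Expr.eval η e) : η X ≤ Expr.eval η g := by
  have hs := h.sSup_eq [] (by simp [bnd]) η
  simp only [sol, Expr.eval_update_of_notMem_occ X _ η g hg] at hs
  have hmem : η X ≤ sSup {r | r ≤ Expr.eval (Function.update η X r) e} :=
    le_sSup (by simpa using hη)
  exact (hmem.trans_eq hs).trans (sSup_le fun _ hr => hr)

/-- solving `ν X = (e₁ ⇒ e₂ ◇ e₃)`. -/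
theorem sol_condL_nu (X : V) (e₁ e₂ e₃ g₃ g₂₃ : Expr V)
    (hg₃ : X ∉ g₃.occ) (hg₂₃ : X ∉ g₂₃.occ)
    (h3 : REquiv [(FP.nu, X, e₃)] [(FP.nu, X, g₃)])
    (h23 : REquiv [(FP.nu, X, Expr.emin e₂ e₃)] [(FP.nu, X, g₂₃)]) :
    REquiv [(FP.nu, X, Expr.condL e₁ e₂ e₃)]
      [(FP.nu, X, Expr.condL (Expr.subst X g₃ e₁) g₂₃ g₃)] := by
  intro F hF η
  have hX : X ∉ bnd F := fun h => (hF X h).1 (by simp [bnd])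
  have hupd : Monotone fun r : EReal => sol F (Function.update η X r) :=
    fun _ _ hrs => sol_mono F (update_le_update_iff.mpr ⟨hrs, fun _ _ => le_rfl⟩)
  have hmono : ∀ e : Expr V, Monotone fun r => Expr.eval (sol F (Function.update η X r)) e :=
    fun e => e.eval_mono.comp hupd
  have hsolX : ∀ r, sol F (Function.update η X r) X = r := fun r => by
    simp [sol_apply_of_notMem_bnd F X hX]
  have h3s := h3.sSup_eq F hX η
  have h23s := h23.sSup_eq F hX η
  have hL := sSup_postfixed_cond
    (f₂ := fun r => Expr.eval (sol F (Function.update η X r)) e₂) (hmono e₁) (hmono e₃)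
  have hR := sSup_postfixed_cond
    (f₂ := fun r => Expr.eval (sol F (Function.update η X r)) g₂₃)
    (hmono (Expr.subst X g₃ e₁)) (hmono g₃)
  have hq := le_apply_sSup_postfixed (hmono (Expr.emin e₂ e₃))
  have hq' := le_apply_sSup_postfixed (hmono g₂₃)
  have hp := le_apply_sSup_postfixed (hmono g₃)
  have hp' : Expr.eval (sol F (Function.update η X
      (sSup {r | r ≤ Expr.eval (sol F (Function.update η X r)) g₃}))) g₃ ≤
      sSup {r | r ≤ Expr.eval (sol F (Function.update η X r)) g₃} :=
    le_sSup (hmono g₃ hp)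
  have hcond : ∀ p, Expr.eval (sol F (Function.update η X p)) g₃ = p →
      Expr.eval (sol F (Function.update η X p)) (Expr.subst X g₃ e₁) =
        Expr.eval (sol F (Function.update η X p)) e₁ := by
    intro p hpe
    have hself : Function.update (sol F (Function.update η X p)) X p =
        sol F (Function.update η X p) := Function.update_eq_self_iff.mpr (hsolX p).symm
    rw [Expr.eval_subst, hpe, hself]
  have hinf : sSup {r | r ≤ Expr.eval (sol F (Function.update η X r)) g₂₃ ⊓
        Expr.eval (sol F (Function.update η X r)) g₃} =
      sSup {r | r ≤ Expr.eval (sol F (Function.update η X r)) g₂₃} := by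
    refine le_antisymm (sSup_le_sSup fun r hr => Set.mem_ofPred.mpr (le_trans hr inf_le_left))
      (le_sSup (le_inf hq' ?_))
    rw [h23s] at hq
    have := h3.le_eval hg₃ (η := sol F (Function.update η X
      (sSup {r | r ≤ Expr.eval (sol F (Function.update η X r)) g₂₃})))
      (by rw [hsolX]; exact hq.trans inf_le_right)
    rwa [hsolX] at this
  have key : sSup {r | r ≤ Expr.eval (sol F (Function.update η X r)) (Expr.condL e₁ e₂ e₃)} =
      sSup {r | r ≤ Expr.eval (sol F (Function.update η X r))
        (Expr.condL (Expr.subst X g₃ e₁) g₂₃ g₃)} := by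
    refine hL.trans (Eq.trans ?_ hR.symm)
    simp only [Expr.eval] at h23s
    rw [hinf, hcond _ (le_antisymm hp' hp), h3s, h23s]
  simp only [List.cons_append, List.nil_append, sol, key]

end
end RESpaper
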